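/- Let T be a continuous Archimedean t-norm on [0,1]. Then for all u, v ∈ [0,1] and every real t > 0: if T(u,v) = 0 then (T(u,v))_T^(t) = 0, and if T(u,v) ∈ (0,1] then (T(u,v))_T^(t) = T(u_T^(t), v_T^(t)). -/

import Mathlib

open Set

/-- A t-norm on `[0,1]`: commutative, associative, nondecreasing in each argument,
with neutral element `1`. -/
structure IsTnorm (T : ℝ → ℝ → ℝ) : Prop where
  maps_to : ∀ x ∈ Icc (0:ℝ) 1, ∀ y ∈ Icc (0:ℝ) 1, T x y ∈ Icc (0:ℝ) 1
  comm : ∀ x ∈ Icc (0:ℝ) 1, ∀ y ∈ Icc (0:ℝ) 1, T x y = T y x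
  assoc : ∀ x ∈ Icc (0:ℝ) 1, ∀ y ∈ Icc (0:ℝ) 1, ∀ z ∈ Icc (0:ℝ) 1,
    T (T x y) z = T x (T y z)
  mono : ∀ x ∈ Icc (0:ℝ) 1, ∀ y ∈ Icc (0:ℝ) 1, ∀ z ∈ Icc (0:ℝ) 1,
    y ≤ z → T x y ≤ T x z
  one : ∀ x ∈ Icc (0:ℝ) 1, T x 1 = x

/-- A t-conorm on `[0,1]`: commutative, associative, nondecreasing in each argument,
with neutral element `0`. -/
structure IsTconorm (S : ℝ → ℝ → ℝ) : Prop where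
  maps_to : ∀ x ∈ Icc (0:ℝ) 1, ∀ y ∈ Icc (0:ℝ) 1, S x y ∈ Icc (0:ℝ) 1
  comm : ∀ x ∈ Icc (0:ℝ) 1, ∀ y ∈ Icc (0:ℝ) 1, S x y = S y x
  assoc : ∀ x ∈ Icc (0:ℝ) 1, ∀ y ∈ Icc (0:ℝ) 1, ∀ z ∈ Icc (0:ℝ) 1,
    S (S x y) z = S x (S y z)
  mono : ∀ x ∈ Icc (0:ℝ) 1, ∀ y ∈ Icc (0:ℝ) 1, ∀ z ∈ Icc (0:ℝ) 1,
    y ≤ z → S x y ≤ S x z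
  zero : ∀ x ∈ Icc (0:ℝ) 1, S x 0 = x

/-- Continuity of a binary operation on the unit square. -/
def ContinuousOn2 (T : ℝ → ℝ → ℝ) : Prop :=
  ContinuousOn (fun p : ℝ × ℝ => T p.1 p.2) (Icc (0:ℝ) 1 ×ˢ Icc (0:ℝ) 1)

/-- `n`-fold power `u_T^(n)` with respect to a t-norm: `u_T^(0) = 1`,
`u_T^(n+1) = T (u_T^(n)) u`. -/
def Tpow (T : ℝ → ℝ → ℝ) (u : ℝ) : ℕ → ℝ
  | 0 => 1
  | n + 1 => T (Tpow T u n) u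

/-- `n`-fold power `u_S^(n)` with respect to a t-conorm: `u_S^(0) = 0`,
`u_S^(n+1) = S (u_S^(n)) u`. -/
def Spow (S : ℝ → ℝ → ℝ) (u : ℝ) : ℕ → ℝ
  | 0 => 0
  | n + 1 => S (Spow S u n) u

/-- `p`-th root `u_T^(1/p) = sup {v ∈ [0,1] | v_T^(p) < u}`. -/
noncomputable def Troot (T : ℝ → ℝ → ℝ) (u : ℝ) (p : ℕ) : ℝ :=
  sSup {v ∈ Icc (0:ℝ) 1 | Tpow T v p < u}

/-- `p`-th root `u_S^(1/p) = inf {v ∈ [0,1] | v_S^(p) > u}`. -/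
noncomputable def Sroot (S : ℝ → ℝ → ℝ) (u : ℝ) (p : ℕ) : ℝ :=
  sInf {v ∈ Icc (0:ℝ) 1 | u < Spow S v p}

/-- Rational power `u_T^(q/p) = (u_T^(1/p))_T^(q)`, with `r = q/p` in lowest terms. -/
noncomputable def TratPow (T : ℝ → ℝ → ℝ) (u : ℝ) (r : ℚ) : ℝ :=
  Tpow T (Troot T u r.den) r.num.toNat

/-- Rational power `u_S^(q/p) = (u_S^(1/p))_S^(q)`, with `r = q/p` in lowest terms. -/
noncomputable def SratPow (S : ℝ → ℝ → ℝ) (u : ℝ) (r : ℚ) : ℝ :=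
  Spow S (Sroot S u r.den) r.num.toNat

/-- Real power `u_T^(t) = inf {u_T^(r) | r ∈ [0,t] ∩ ℚ}`. -/
noncomputable def TrePow (T : ℝ → ℝ → ℝ) (u : ℝ) (t : ℝ) : ℝ :=
  sInf (TratPow T u '' {r : ℚ | 0 ≤ r ∧ (r : ℝ) ≤ t})

/-- Real power `u_S^(t) = sup {u_S^(r) | r ∈ [0,t] ∩ ℚ}`. -/
noncomputable def SrePow (S : ℝ → ℝ → ℝ) (u : ℝ) (t : ℝ) : ℝ :=
  sSup (SratPow S u '' {r : ℚ | 0 ≤ r ∧ (r : ℝ) ≤ t})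

/-- A t-norm is Archimedean if for all `x, y ∈ (0,1)` there is `n` with `x_T^(n) < y`. -/
def TnormArchimedean (T : ℝ → ℝ → ℝ) : Prop :=
  ∀ x ∈ Ioo (0:ℝ) 1, ∀ y ∈ Ioo (0:ℝ) 1, ∃ n : ℕ, Tpow T x n < y

/-- Strict monotonicity of a t-norm: `T x y < T x z` whenever `x > 0` and `y < z`. -/
def TnormStrictMono (T : ℝ → ℝ → ℝ) : Prop :=
  ∀ x ∈ Icc (0:ℝ) 1, 0 < x → ∀ y ∈ Icc (0:ℝ) 1, ∀ z ∈ Icc (0:ℝ) 1, y < z → T x y < T x z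

/-- Pseudo-inverse of a decreasing `G : [0,1] → [0,∞]`:
`G^(−1)(y) = sup {x ∈ [0,1] | G x > y}`. -/
noncomputable def pseudoInv (G : ℝ → ENNReal) (y : ENNReal) : ℝ :=
  sSup {x ∈ Icc (0:ℝ) 1 | y < G x}

/-- `G : [0,1] → [0,∞]` is an additive generator of the t-norm `T`. -/
structure IsAddGen (T : ℝ → ℝ → ℝ) (G : ℝ → ENNReal) : Prop where
  strictAnti : StrictAntiOn G (Icc (0:ℝ) 1)
  rightContinuousAtZero : ContinuousWithinAt G (Icc (0:ℝ) 1) 0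
  map_one : G 1 = 0
  sum_mem : ∀ x ∈ Icc (0:ℝ) 1, ∀ y ∈ Icc (0:ℝ) 1,
    G x + G y ∈ G '' Icc (0:ℝ) 1 ∪ Icc (G 0) ⊤
  eq_pseudoInv : ∀ x ∈ Icc (0:ℝ) 1, ∀ y ∈ Icc (0:ℝ) 1, T x y = pseudoInv G (G x + G y)

namespace IsTnorm

variable {T : ℝ → ℝ → ℝ} {u v x y z w a b : ℝ}

lemma one_mem : (1:ℝ) ∈ Icc (0:ℝ) 1 := ⟨zero_le_one, le_rfl⟩

lemma zero_mem : (0:ℝ) ∈ Icc (0:ℝ) 1 := ⟨le_rfl, zero_le_one⟩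

lemma one_left (hT : IsTnorm T) (hx : x ∈ Icc (0:ℝ) 1) : T 1 x = x := by
  rw [hT.comm 1 one_mem x hx, hT.one x hx]

lemma le_left (hT : IsTnorm T) (hx : x ∈ Icc (0:ℝ) 1) (hy : y ∈ Icc (0:ℝ) 1) : T x y ≤ x :=
  (hT.mono x hx y hy 1 one_mem hy.2).trans_eq (hT.one x hx)

lemma le_right (hT : IsTnorm T) (hx : x ∈ Icc (0:ℝ) 1) (hy : y ∈ Icc (0:ℝ) 1) : T x y ≤ y :=
  (hT.comm x hx y hy).trans_le (hT.le_left hy hx)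

lemma zero_right (hT : IsTnorm T) (hx : x ∈ Icc (0:ℝ) 1) : T x 0 = 0 :=
  le_antisymm (hT.le_right hx zero_mem) (hT.maps_to x hx 0 zero_mem).1

lemma mono₂ (hT : IsTnorm T) (hx : x ∈ Icc (0:ℝ) 1) (hy : y ∈ Icc (0:ℝ) 1)
    (ha : a ∈ Icc (0:ℝ) 1) (hb : b ∈ Icc (0:ℝ) 1) (hxa : x ≤ a) (hyb : y ≤ b) :
    T x y ≤ T a b :=
  calc T x y ≤ T x b := hT.mono x hx y hy b hb hyb
    _ = T b x := hT.comm x hx b hb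
    _ ≤ T b a := hT.mono b hb x hx a ha hxa
    _ = T a b := hT.comm b hb a ha

lemma mul_mul_mul_comm (hT : IsTnorm T) (hx : x ∈ Icc (0:ℝ) 1) (hy : y ∈ Icc (0:ℝ) 1)
    (ha : a ∈ Icc (0:ℝ) 1) (hb : b ∈ Icc (0:ℝ) 1) :
    T (T x y) (T a b) = T (T x a) (T y b) := by
  have hm := hT.maps_to
  rw [hT.assoc x hx y hy _ (hm a ha b hb), ← hT.assoc y hy a ha b hb, hT.comm y hy a ha,
    hT.assoc a ha y hy b hb, ← hT.assoc x hx a ha _ (hm y hy b hb)]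

lemma tpow_mem (hT : IsTnorm T) (hu : u ∈ Icc (0:ℝ) 1) (n : ℕ) : Tpow T u n ∈ Icc (0:ℝ) 1 := by
  induction n with
  | zero => exact one_mem
  | succ n ih => exact hT.maps_to _ ih _ hu

lemma tpow_antitone (hT : IsTnorm T) (hu : u ∈ Icc (0:ℝ) 1) : Antitone (Tpow T u) :=
  antitone_nat_of_succ_le fun n => hT.le_left (hT.tpow_mem hu n) hu

lemma tpow_le (hT : IsTnorm T) (hu : u ∈ Icc (0:ℝ) 1) {n : ℕ} (hn : n ≠ 0) : Tpow T u n ≤ u :=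
  (hT.tpow_antitone hu (Nat.one_le_iff_ne_zero.2 hn)).trans_eq (hT.one_left hu)

lemma tpow_zero_base (hT : IsTnorm T) {n : ℕ} (hn : n ≠ 0) : Tpow T 0 n = 0 :=
  le_antisymm (hT.tpow_le zero_mem hn) (hT.tpow_mem zero_mem n).1

lemma tpow_one_base (hT : IsTnorm T) (n : ℕ) : Tpow T 1 n = 1 := by
  induction n with
  | zero => rfl
  | succ n ih => rw [Tpow, ih, hT.one 1 one_mem]

lemma tpow_mono_base (hT : IsTnorm T) (hx : x ∈ Icc (0:ℝ) 1) (hy : y ∈ Icc (0:ℝ) 1)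
    (hxy : x ≤ y) (n : ℕ) : Tpow T x n ≤ Tpow T y n := by
  induction n with
  | zero => exact le_rfl
  | succ n ih => exact hT.mono₂ (hT.tpow_mem hx n) hx (hT.tpow_mem hy n) hy ih hxy

lemma mul_tpow (hT : IsTnorm T) (hx : x ∈ Icc (0:ℝ) 1) (hy : y ∈ Icc (0:ℝ) 1) (n : ℕ) :
    Tpow T (T x y) n = T (Tpow T x n) (Tpow T y n) := by
  induction n with
  | zero => exact (hT.one 1 one_mem).symm
  | succ n ih =>
    rw [Tpow, ih, hT.mul_mul_mul_comm (hT.tpow_mem hx n) (hT.tpow_mem hy n) hx hy]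
    rfl

lemma tpow_add (hT : IsTnorm T) (hu : u ∈ Icc (0:ℝ) 1) (m n : ℕ) :
    Tpow T u (m + n) = T (Tpow T u m) (Tpow T u n) := by
  induction n with
  | zero => exact (hT.one _ (hT.tpow_mem hu m)).symm
  | succ n ih =>
    rw [← add_assoc, Tpow, ih, hT.assoc _ (hT.tpow_mem hu m) _ (hT.tpow_mem hu n) _ hu]
    rfl

lemma tpow_mul (hT : IsTnorm T) (hu : u ∈ Icc (0:ℝ) 1) (m n : ℕ) :
    Tpow T u (m * n) = Tpow T (Tpow T u m) n := by
  induction n with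
  | zero => rfl
  | succ n ih => rw [Nat.mul_succ, hT.tpow_add hu, ih]; rfl

lemma continuousOn_right (hTc : ContinuousOn2 T) (hx : x ∈ Icc (0:ℝ) 1) :
    ContinuousOn (fun y => T x y) (Icc (0:ℝ) 1) :=
  ContinuousOn.comp (g := fun p : ℝ × ℝ => T p.1 p.2) (f := fun y => (x, y)) hTc
    (by fun_prop) fun _ hy => ⟨hx, hy⟩

lemma continuousOn_tpow (hT : IsTnorm T) (hTc : ContinuousOn2 T) (n : ℕ) :
    ContinuousOn (fun u => Tpow T u n) (Icc (0:ℝ) 1) := by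
  induction n with
  | zero => exact continuousOn_const
  | succ n ih =>
    exact ContinuousOn.comp (g := fun p : ℝ × ℝ => T p.1 p.2) (f := fun u => (Tpow T u n, u)) hTc
      (ih.prodMk continuousOn_id) fun _ hu => ⟨hT.tpow_mem hu n, hu⟩

/-- In a continuous t-norm every `y ≤ z` is divisible by `z`. -/
lemma exists_eq_mul_of_le (hT : IsTnorm T) (hTc : ContinuousOn2 T) (hz : z ∈ Icc (0:ℝ) 1)
    (hy : 0 ≤ y) (hyz : y ≤ z) : ∃ c ∈ Icc (0:ℝ) 1, T z c = y :=
  intermediate_value_Icc zero_le_one (continuousOn_right hTc hz)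
    ⟨(hT.zero_right hz).trans_le hy, hyz.trans_eq (hT.one z hz).symm⟩

lemma mul_lt_self (hT : IsTnorm T) (hA : TnormArchimedean T) (hw : w ∈ Icc (0:ℝ) 1)
    (hw0 : 0 < w) {c : ℝ} (hc : c ∈ Icc (0:ℝ) 1) (hc1 : c < 1) : T w c < w := by
  refine (hT.le_left hw hc).lt_of_ne fun h => ?_
  rcases hw.2.eq_or_lt with rfl | hw1
  · rw [hT.one_left hc] at h
    exact hc1.ne h
  rcases hc.1.eq_or_lt with rfl | hc0
  · rw [hT.zero_right hw] at h
    exact hw0.ne h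
  have hpow : ∀ n, T w (Tpow T c n) = w := by
    intro n
    induction n with
    | zero => exact hT.one w hw
    | succ n ih => rw [Tpow, ← hT.assoc w hw _ (hT.tpow_mem hc n) c hc, ih, h]
  obtain ⟨n, hn⟩ := hA c ⟨hc0, hc1⟩ w ⟨hw0, hw1⟩
  have := hT.le_right hw (hT.tpow_mem hc n)
  rw [hpow] at this
  exact this.not_gt hn

lemma tpow_lt_tpow (hT : IsTnorm T) (hTc : ContinuousOn2 T) (hA : TnormArchimedean T)
    (hx : x ∈ Icc (0:ℝ) 1) (hy : y ∈ Icc (0:ℝ) 1) (hxy : x < y) {n : ℕ} (hn : n ≠ 0)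
    (h0 : 0 < Tpow T y n) : Tpow T x n < Tpow T y n := by
  obtain ⟨c, hc, rfl⟩ := hT.exists_eq_mul_of_le hTc hy hx.1 hxy.le
  have hc1 : c < 1 := hc.2.lt_of_ne fun h => by
    rw [h, hT.one y hy] at hxy
    exact lt_irrefl _ hxy
  rw [hT.mul_tpow hy hc]
  exact hT.mul_lt_self hA (hT.tpow_mem hy n) h0 (hT.tpow_mem hc n)
    ((hT.tpow_le hc hn).trans_lt hc1)

lemma troot_tpow (hT : IsTnorm T) (hTc : ContinuousOn2 T) (hA : TnormArchimedean T)
    (hx : x ∈ Icc (0:ℝ) 1) {p : ℕ} (hp : p ≠ 0) (h0 : 0 < Tpow T x p) :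
    Troot T (Tpow T x p) p = x := by
  have hx0 : 0 < x := h0.trans_le (hT.tpow_le hx hp)
  have : {v ∈ Icc (0:ℝ) 1 | Tpow T v p < Tpow T x p} = Ico 0 x := by
    ext v
    constructor
    · rintro ⟨hv, hlt⟩
      exact ⟨hv.1, lt_of_not_ge fun h => (hT.tpow_mono_base hx hv h p).not_gt hlt⟩
    · rintro ⟨hv0, hvx⟩
      have hv : v ∈ Icc (0:ℝ) 1 := ⟨hv0, hvx.le.trans hx.2⟩
      exact ⟨hv, hT.tpow_lt_tpow hTc hA hv hx hvx hp h0⟩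
  rw [Troot, this, csSup_Ico hx0]

lemma exists_tpow_eq (hT : IsTnorm T) (hTc : ContinuousOn2 T) (hu : u ∈ Icc (0:ℝ) 1)
    {p : ℕ} (hp : p ≠ 0) : ∃ x ∈ Icc (0:ℝ) 1, Tpow T x p = u :=
  intermediate_value_Icc zero_le_one (hT.continuousOn_tpow hTc p)
    ⟨(hT.tpow_zero_base hp).trans_le hu.1, hu.2.trans_eq (hT.tpow_one_base p).symm⟩

lemma troot_mem (T : ℝ → ℝ → ℝ) (u : ℝ) (p : ℕ) : Troot T u p ∈ Icc (0:ℝ) 1 :=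
  ⟨Real.sSup_nonneg fun _ h => h.1.1, Real.sSup_le (fun _ h => h.1.2) zero_le_one⟩

lemma tpow_troot (hT : IsTnorm T) (hTc : ContinuousOn2 T) (hA : TnormArchimedean T)
    (hu : u ∈ Icc (0:ℝ) 1) (hu0 : 0 < u) {p : ℕ} (hp : p ≠ 0) :
    Tpow T (Troot T u p) p = u := by
  obtain ⟨x, hx, rfl⟩ := hT.exists_tpow_eq hTc hu hp
  rw [hT.troot_tpow hTc hA hx hp hu0]

lemma troot_mul (hT : IsTnorm T) (hTc : ContinuousOn2 T) (hA : TnormArchimedean T)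
    (hu : u ∈ Icc (0:ℝ) 1) (hv : v ∈ Icc (0:ℝ) 1) (h0 : 0 < T u v) {p : ℕ} (hp : p ≠ 0) :
    Troot T (T u v) p = T (Troot T u p) (Troot T v p) := by
  have hpow : Tpow T (T (Troot T u p) (Troot T v p)) p = T u v := by
    rw [hT.mul_tpow (troot_mem T u p) (troot_mem T v p),
      hT.tpow_troot hTc hA hu (h0.trans_le (hT.le_left hu hv)) hp,
      hT.tpow_troot hTc hA hv (h0.trans_le (hT.le_right hu hv)) hp]
  have := hT.troot_tpow hTc hA (hT.maps_to _ (troot_mem T u p) _ (troot_mem T v p)) hp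
    (h0.trans_eq hpow.symm)
  rwa [hpow] at this

lemma tratPow_mul (hT : IsTnorm T) (hTc : ContinuousOn2 T) (hA : TnormArchimedean T)
    (hu : u ∈ Icc (0:ℝ) 1) (hv : v ∈ Icc (0:ℝ) 1) (h0 : 0 < T u v) (r : ℚ) :
    TratPow T (T u v) r = T (TratPow T u r) (TratPow T v r) := by
  rw [TratPow, hT.troot_mul hTc hA hu hv h0 r.den_nz,
    hT.mul_tpow (troot_mem T u _) (troot_mem T v _)]
  rfl

lemma tratPow_mem (hT : IsTnorm T) (u : ℝ) (r : ℚ) : TratPow T u r ∈ Icc (0:ℝ) 1 :=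
  hT.tpow_mem (troot_mem T u _) _

/-- The root of order `p` is a power of the root of order `p * q`. -/
lemma troot_eq_tpow_troot_mul (hT : IsTnorm T) (hTc : ContinuousOn2 T) (hA : TnormArchimedean T)
    (hu : u ∈ Icc (0:ℝ) 1) (hu0 : 0 < u) {p q : ℕ} (hp : p ≠ 0) (hq : q ≠ 0) :
    Troot T u p = Tpow T (Troot T u (p * q)) q := by
  have hm := troot_mem T u (p * q)
  have hpow : Tpow T (Tpow T (Troot T u (p * q)) q) p = u := by
    rw [← hT.tpow_mul hm, mul_comm q p, hT.tpow_troot hTc hA hu hu0 (mul_ne_zero hp hq)]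
  have := hT.troot_tpow hTc hA (hT.tpow_mem hm q) hp (hu0.trans_eq hpow.symm)
  rwa [hpow] at this

lemma tratPow_anti (hT : IsTnorm T) (hTc : ContinuousOn2 T) (hA : TnormArchimedean T)
    (hu : u ∈ Icc (0:ℝ) 1) (hu0 : 0 < u) {r s : ℚ} (hr : 0 ≤ r) (hrs : r ≤ s) :
    TratPow T u s ≤ TratPow T u r := by
  have hm := troot_mem T u (r.den * s.den)
  rw [TratPow, TratPow, hT.troot_eq_tpow_troot_mul hTc hA hu hu0 s.den_nz r.den_nz,
    hT.troot_eq_tpow_troot_mul hTc hA hu hu0 r.den_nz s.den_nz, mul_comm s.den r.den,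
    ← hT.tpow_mul hm, ← hT.tpow_mul hm]
  apply hT.tpow_antitone hm
  have h := (Rat.le_iff r s).1 hrs
  zify
  rw [Int.toNat_of_nonneg (Rat.num_nonneg.2 hr),
    Int.toNat_of_nonneg (Rat.num_nonneg.2 (hr.trans hrs))]
  linarith

lemma bddBelow_tratPow (hT : IsTnorm T) (u : ℝ) (S : Set ℚ) : BddBelow (TratPow T u '' S) :=
  ⟨0, by rintro _ ⟨r, -, rfl⟩; exact (hT.tratPow_mem u r).1⟩

lemma trePow_le (hT : IsTnorm T) {t : ℝ} {r : ℚ} (hr : 0 ≤ r) (hrt : (r:ℝ) ≤ t) :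
    TrePow T u t ≤ TratPow T u r :=
  csInf_le (hT.bddBelow_tratPow u _) ⟨r, ⟨hr, hrt⟩, rfl⟩

lemma nonempty_tratPow (T : ℝ → ℝ → ℝ) (u : ℝ) {t : ℝ} (ht : 0 ≤ t) :
    (TratPow T u '' {r : ℚ | 0 ≤ r ∧ (r : ℝ) ≤ t}).Nonempty :=
  ⟨_, 0, ⟨le_rfl, by simpa using ht⟩, rfl⟩

lemma le_trePow {t : ℝ} (ht : 0 ≤ t)
    (h : ∀ r : ℚ, 0 ≤ r → (r:ℝ) ≤ t → a ≤ TratPow T u r) : a ≤ TrePow T u t :=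
  le_csInf (nonempty_tratPow T u ht) (by rintro _ ⟨r, hr, rfl⟩; exact h r hr.1 hr.2)

lemma trePow_mem (hT : IsTnorm T) {t : ℝ} (ht : 0 ≤ t) : TrePow T u t ∈ Icc (0:ℝ) 1 :=
  ⟨le_trePow ht fun r _ _ => (hT.tratPow_mem u r).1,
    (hT.trePow_le le_rfl (by simpa using ht)).trans (hT.tratPow_mem u 0).2⟩

lemma exists_tratPow_lt {t : ℝ} (ht : 0 ≤ t) (h : TrePow T u t < a) :
    ∃ r : ℚ, 0 ≤ r ∧ (r:ℝ) ≤ t ∧ TratPow T u r < a := by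
  obtain ⟨_, ⟨r, hr, rfl⟩, hlt⟩ := exists_lt_of_csInf_lt (nonempty_tratPow T u ht) h
  exact ⟨r, hr.1, hr.2, hlt⟩

lemma trePow_zero_base (hT : IsTnorm T) {t : ℝ} (ht : 0 < t) : TrePow T 0 t = 0 := by
  refine le_antisymm ?_ (hT.trePow_mem ht.le).1
  obtain ⟨r, hr0, hrt⟩ := exists_rat_btwn ht
  have hr : 0 < r := by exact_mod_cast hr0
  refine (hT.trePow_le hr.le hrt.le).trans_eq ?_
  have hroot : Troot T 0 r.den = 0 := by
    have : {v ∈ Icc (0:ℝ) 1 | Tpow T v r.den < 0} = ∅ :=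
      eq_empty_of_forall_notMem fun v hv => (hT.tpow_mem hv.1 _).1.not_gt hv.2
    rw [Troot, this, Real.sSup_empty]
  have hnum := Rat.num_pos.2 hr
  rw [TratPow, hroot, hT.tpow_zero_base (by omega)]

lemma trePow_mul (hT : IsTnorm T) (hTc : ContinuousOn2 T) (hA : TnormArchimedean T)
    (hu : u ∈ Icc (0:ℝ) 1) (hv : v ∈ Icc (0:ℝ) 1) (h0 : 0 < T u v) {t : ℝ} (ht : 0 ≤ t) :
    TrePow T (T u v) t = T (TrePow T u t) (TrePow T v t) := by
  have hu0 := h0.trans_le (hT.le_left hu hv)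
  have hv0 := h0.trans_le (hT.le_right hu hv)
  have hmu : TrePow T u t ∈ Icc (0:ℝ) 1 := hT.trePow_mem ht
  have hmv : TrePow T v t ∈ Icc (0:ℝ) 1 := hT.trePow_mem ht
  apply le_antisymm
  · refine le_of_forall_pos_lt_add fun ε hε => ?_
    obtain ⟨δ, hδ, hclose⟩ := Metric.continuousWithinAt_iff.1
      (hTc (TrePow T u t, TrePow T v t) ⟨hmu, hmv⟩) ε hε
    obtain ⟨r, hr0, hrt, hr⟩ := exists_tratPow_lt ht (lt_add_of_pos_right (TrePow T u t) hδ)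
    obtain ⟨s, hs0, hst, hs⟩ := exists_tratPow_lt ht (lt_add_of_pos_right (TrePow T v t) hδ)
    have hm0 : 0 ≤ max r s := hr0.trans (le_max_left r s)
    have hmt : ((max r s : ℚ) : ℝ) ≤ t := by
      rw [Rat.cast_max]
      exact max_le hrt hst
    have hru := hT.tratPow_anti hTc hA hu hu0 hr0 (le_max_left r s)
    have hsv := hT.tratPow_anti hTc hA hv hv0 hs0 (le_max_right r s)
    have hlu := hT.trePow_le (u := u) hm0 hmt
    have hlv := hT.trePow_le (u := v) hm0 hmt
    have hd := hclose (x := (TratPow T u (max r s), TratPow T v (max r s)))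
      ⟨hT.tratPow_mem u _, hT.tratPow_mem v _⟩ (by
        rw [Prod.dist_eq, max_lt_iff]
        simp only [Real.dist_eq, abs_lt]
        refine ⟨⟨?_, ?_⟩, ?_, ?_⟩ <;> linarith)
    rw [Real.dist_eq, abs_lt] at hd
    have := hT.trePow_le (u := T u v) hm0 hmt
    rw [hT.tratPow_mul hTc hA hu hv h0] at this
    simp only at hd
    linarith [hd.2]
  · refine le_trePow ht fun r hr hrt => ?_
    rw [hT.tratPow_mul hTc hA hu hv h0]
    exact hT.mono₂ hmu hmv (hT.tratPow_mem u r) (hT.tratPow_mem v r)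
      (hT.trePow_le hr hrt) (hT.trePow_le hr hrt)

end IsTnorm

/-- For a continuous Archimedean t-norm `T`: if `T u v = 0` then
`(T u v)_T^(t) = 0`, and if `T u v ∈ (0,1]` then
`(T u v)_T^(t) = T (u_T^(t)) (v_T^(t))`. -/
theorem archimedean_power_stability (T : ℝ → ℝ → ℝ) (hT : IsTnorm T)
    (hTc : ContinuousOn2 T) (hA : TnormArchimedean T) :
    ∀ u ∈ Icc (0:ℝ) 1, ∀ v ∈ Icc (0:ℝ) 1, ∀ t : ℝ, 0 < t →
      (T u v = 0 → TrePow T (T u v) t = 0) ∧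
      (T u v ∈ Ioc (0:ℝ) 1 → TrePow T (T u v) t = T (TrePow T u t) (TrePow T v t)) := by
  intro u hu v hv t ht
  refine ⟨fun h => ?_, fun h => hT.trePow_mul hTc hA hu hv h.1 ht.le⟩
  rw [h, hT.trePow_zero_base ht]
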